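/- Let n, d ≥ 1, N := n!, and fix a bijection k ↦ c_k from Fin N to the symmetric group S_n. On ℂ^N ⊗ (ℂ^d)^{⊗n} define the unitary W := Σ_{k=0}^{N−1} |k⟩⟨k| ⊗ P_n(c_k), and let V be any N×N unitary with V e₀ = (1/√N)·Σ_{k=0}^{N−1} e_k. Then (⟨e₀| ⊗ I)·(V†⊗I)·W·(V⊗I)·(|e₀⟩ ⊗ I) = Π_n; i.e., the LCU circuit U := (V†⊗I)W(V⊗I) is a block encoding of the symmetric-subspace projector Π_n. (Proposition: quantum circuit of the purification protocol.) -/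

import Mathlib

open Matrix Kronecker

/-- Permutation matrix on `(ℂ^d)^{⊗n}` permuting tensor factors. -/
noncomputable def permMat (n d : ℕ) (σ : Equiv.Perm (Fin n)) :
    Matrix (Fin n → Fin d) (Fin n → Fin d) ℂ :=
  Matrix.of fun v w => if v = w ∘ σ then 1 else 0

/-- Projector onto the symmetric subspace of `(ℂ^d)^{⊗n}`. -/
noncomputable def symProj (n d : ℕ) :
    Matrix (Fin n → Fin d) (Fin n → Fin d) ℂ :=
  ((n.factorial : ℂ)⁻¹) • ∑ σ : Equiv.Perm (Fin n), permMat n d σ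

/-- The select unitary `W = ∑_k |k⟩⟨k| ⊗ P_n(c_k)` of the LCU circuit. -/
noncomputable def selW (n d : ℕ) (c : Fin (Nat.factorial n) ≃ Equiv.Perm (Fin n)) :
    Matrix (Fin (Nat.factorial n) × (Fin n → Fin d))
      (Fin (Nat.factorial n) × (Fin n → Fin d)) ℂ :=
  Matrix.of fun p q => if p.1 = q.1 then permMat n d (c p.1) p.2 q.2 else 0

/-- The `(i, j)` ancilla block of `(A ⊗ I) W (B ⊗ I)` is the combination of the `P_n(c_k)` with
coefficients `A i k * B k j`. -/
theorem kronecker_mul_selW_mul_kronecker_apply (n d : ℕ)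
    (c : Fin (Nat.factorial n) ≃ Equiv.Perm (Fin n))
    (A B : Matrix (Fin (Nat.factorial n)) (Fin (Nat.factorial n)) ℂ)
    (i j : Fin (Nat.factorial n)) (v w : Fin n → Fin d) :
    ((A ⊗ₖ (1 : Matrix (Fin n → Fin d) (Fin n → Fin d) ℂ)) * selW n d c *
        (B ⊗ₖ (1 : Matrix (Fin n → Fin d) (Fin n → Fin d) ℂ))) (i, v) (j, w)
      = ∑ k, A i k * B k j * permMat n d (c k) v w := by
  simp only [Matrix.mul_apply, Fintype.sum_prod_type, kroneckerMap_apply, selW, Matrix.of_apply,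
    Matrix.one_apply, mul_ite, ite_mul, mul_one, mul_zero, zero_mul,
    Finset.sum_ite_eq', Finset.mem_univ, if_true]
  refine Finset.sum_congr rfl fun k _ => ?_
  rw [Finset.sum_comm]
  simp only [Finset.sum_ite_eq, Finset.sum_ite_eq', Finset.mem_univ, if_true]
  ring

/-- quantum circuit of the purification protocol. Let `N = n!`,
`c` a bijection `Fin N ≃ S_n`, `W = ∑_k |k⟩⟨k| ⊗ P_n(c_k)` and `V` any `N×N`
unitary with `V e₀ = (1/√N) ∑_k e_k`. Then the top-left ancilla block of the LCU
circuit `U = (V†⊗I) W (V⊗I)` is the symmetric-subspace projector `Π_n`. -/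
theorem stmt11 (n d : ℕ) (hn : 1 ≤ n) (hd : 1 ≤ d)
    (c : Fin (Nat.factorial n) ≃ Equiv.Perm (Fin n))
    (V : Matrix (Fin (Nat.factorial n)) (Fin (Nat.factorial n)) ℂ)
    (hV : V ∈ Matrix.unitaryGroup (Fin (Nat.factorial n)) ℂ)
    (hV0 : V *ᵥ Pi.single (⟨0, Nat.factorial_pos n⟩ : Fin (Nat.factorial n)) 1
      = fun _ => ((Real.sqrt (Nat.factorial n) : ℝ) : ℂ)⁻¹) :
    (Matrix.of fun v w : Fin n → Fin d =>
       ((Vᴴ ⊗ₖ (1 : Matrix (Fin n → Fin d) (Fin n → Fin d) ℂ)) * selW n d c *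
          (V ⊗ₖ (1 : Matrix (Fin n → Fin d) (Fin n → Fin d) ℂ)))
         ((⟨0, Nat.factorial_pos n⟩ : Fin (Nat.factorial n)), v)
         ((⟨0, Nat.factorial_pos n⟩ : Fin (Nat.factorial n)), w))
      = symProj n d := by
  have hcol (k) : V k ⟨0, Nat.factorial_pos n⟩ = ((Real.sqrt (Nat.factorial n) : ℝ) : ℂ)⁻¹ := by
    simpa using congrFun hV0 k
  have hsq : star (((Real.sqrt (Nat.factorial n) : ℝ) : ℂ)⁻¹) *
      ((Real.sqrt (Nat.factorial n) : ℝ) : ℂ)⁻¹ = (Nat.factorial n : ℂ)⁻¹ := by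
    rw [← Complex.ofReal_inv, Complex.star_def, Complex.conj_ofReal, ← Complex.ofReal_mul,
      ← mul_inv, Real.mul_self_sqrt (Nat.cast_nonneg _)]
    push_cast
    rfl
  ext v w
  rw [Matrix.of_apply, kronecker_mul_selW_mul_kronecker_apply]
  simp only [conjTranspose_apply, hcol, hsq, symProj, Matrix.smul_apply, Matrix.sum_apply,
    smul_eq_mul]
  rw [← Finset.mul_sum, c.sum_comp fun σ => permMat n d σ v w]
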